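/- For every n ≥ 1 and every c ∈ (0,1), the Tate algebra Tₙ = K⟨x₁,…,xₙ⟩ over K is c-rigid. -/

import Mathlib

/-- A `c`-close product on a commutative nonarchimedean Banach algebra `A` over `K`:
a continuous `K`-bilinear, commutative and associative multiplication `∗` (packaged as
`m : A →L[K] A →L[K] A`) such that `‖x∗y − x·y‖ < c·‖x·y‖` whenever `x·y ≠ 0`, and
`x∗y = 0` whenever `x·y = 0`. -/
def IsCCloseProduct {K : Type*} [NormedField K] {A : Type*} [NormedCommRing A]
    [NormedAlgebra K A] (c : ℝ) (m : A →L[K] A →L[K] A) : Prop :=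
  (∀ x y : A, m x y = m y x) ∧
  (∀ x y z : A, m (m x y) z = m x (m y z)) ∧
  (∀ x y : A, x * y ≠ 0 → ‖m x y - x * y‖ < c * ‖x * y‖) ∧
  (∀ x y : A, x * y = 0 → m x y = 0)

/-- `A` is `c`-rigid if every `c`-close product `∗` on `A` is intertwined with the
original product by a `K`-linear bijective isometry `φ` with `‖φ x − x‖ ≤ c·‖x‖`. -/
def IsCRigid (K : Type*) [NormedField K] (A : Type*) [NormedCommRing A]
    [NormedAlgebra K A] (c : ℝ) : Prop :=
  ∀ m : A →L[K] A →L[K] A, IsCCloseProduct c m →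
    ∃ φ : A →ₗ[K] A, Function.Bijective φ ∧ (∀ x : A, ‖φ x‖ = ‖x‖) ∧
      (∀ x y : A, φ (x * y) = m (φ x) (φ y)) ∧ ∀ x : A, ‖φ x - x‖ ≤ c * ‖x‖

theorem tate_exists_powers {A : Type*} (op : A → A → A) (e : A) (hcomm : ∀ x y, op x y = op y x)
    (hassoc : ∀ x y z, op (op x y) z = op x (op y z)) (hone : ∀ x, op e x = x)
    (n : ℕ) (x : Fin n → A) :
    ∃ P : (Fin n →₀ ℕ) → A, P 0 = e ∧ (∀ I J, P (I + J) = op (P I) (P J)) ∧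
      ∀ i, P (Finsupp.single i 1) = x i := by
  letI : CommMonoid A :=
    { mul := op, one := e, mul_assoc := hassoc, mul_comm := hcomm, one_mul := hone,
      mul_one := fun a => (hcomm a e).trans (hone a) }
  refine ⟨fun I => ∏ i, x i ^ I i, ?_, ?_, ?_⟩
  · simp only [Finsupp.coe_zero, Pi.zero_apply, pow_zero, Finset.prod_const_one]
    rfl
  · intro I J
    simp only [Finsupp.coe_add, Pi.add_apply, pow_add, Finset.prod_mul_distrib]
    rfl
  · intro i
    simp only
    rw [Finset.prod_eq_single i]
    · simp
    · intro j _ hj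
      simp [Finsupp.single_apply, hj.symm]
    · simp

theorem tate_surj {A : Type*} [NormedCommRing A] [CompleteSpace A] (c : ℝ) (hc0 : 0 < c)
    (hc1 : c < 1) (f : A → A) (hsub : ∀ x y, f (x - y) = f x - f y)
    (hf : ∀ x, ‖f x - x‖ ≤ c * ‖x‖) : Function.Surjective f := by
  intro z
  have hC : ContractingWith ⟨c, hc0.le⟩ (fun y => z - (f y - y)) := by
    refine ⟨by exact_mod_cast hc1, LipschitzWith.of_dist_le_mul fun a b => ?_⟩
    have := hf (b - a)
    rw [hsub] at this
    rw [dist_eq_norm, dist_eq_norm, norm_sub_rev a b]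
    refine le_trans (le_of_eq ?_) this
    congr 1
    abel
  obtain ⟨p, hp⟩ : ∃ p, z - (f p - p) = p := ⟨_, hC.fixedPoint_isFixedPt⟩
  refine ⟨p, ?_⟩
  have h3 : z - f p = 0 := by
    rw [← sub_eq_zero.mpr hp]; abel
  exact (sub_eq_zero.mp h3).symm

theorem tate_norm_eq {A : Type*} [NormedCommRing A] [IsUltrametricDist A] {c : ℝ} (hc1 : c < 1)
    {u v : A} (h : ‖u - v‖ ≤ c * ‖v‖) : ‖u‖ = ‖v‖ := by
  rcases eq_or_ne v 0 with rfl | hv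
  · simp at h; simp [h]
  · have hv' : 0 < ‖v‖ := norm_pos_iff.mpr hv
    have hlt : ‖u - v‖ < ‖v‖ := by nlinarith
    have := IsUltrametricDist.norm_add_eq_max_of_norm_ne_norm hlt.ne
    rw [sub_add_cancel, max_eq_right hlt.le] at this
    exact this

/-- rigidity of the Tate algebra. For every `n ≥ 1` and `c ∈ (0,1)`,
the Tate algebra `Tₙ = K⟨x₁,…,xₙ⟩` is `c`-rigid. The Tate algebra is characterized
(up to isometric isomorphism of Banach algebras) as a commutative nonarchimedean Banach
algebra `A` over `K` with elements `x 1, …, x n` such that every `e ∈ A` has a unique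
convergent monomial expansion `e = Σ_I a_I • x^I` and the norm is the Gauss norm
`‖e‖ = sup_I ‖a_I‖`. -/
theorem tateAlgebra_isCRigid
    {K : Type*} [NormedField K] [IsUltrametricDist K] [CompleteSpace K]
    {A : Type*} [NormedCommRing A] [NormedAlgebra K A] [CompleteSpace A]
    [IsUltrametricDist A]
    (n : ℕ) (hn : 1 ≤ n) (x : Fin n → A)
    (hexp : ∀ e : A, ∃! a : (Fin n →₀ ℕ) → K,
      HasSum (fun I : Fin n →₀ ℕ => a I • ∏ i : Fin n, x i ^ I i) e)
    (hnorm : ∀ (e : A) (a : (Fin n →₀ ℕ) → K),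
      HasSum (fun I : Fin n →₀ ℕ => a I • ∏ i : Fin n, x i ^ I i) e →
      IsLUB (Set.range fun I : Fin n →₀ ℕ => ‖a I‖) ‖e‖)
    (c : ℝ) (hc0 : 0 < c) (hc1 : c < 1) :
    IsCRigid K A c := by
  intro m hm
  obtain ⟨hcomm, hassoc, hclose, hzero⟩ := hm
  have hcl : ∀ u v : A, ‖m u v - u * v‖ ≤ c * ‖u * v‖ := by
    intro u v
    by_cases h : u * v = 0
    · simp [hzero u v h, h]
    · exact (hclose u v h).le
  -- monomials
  set X : (Fin n →₀ ℕ) → A := fun I => ∏ i, x i ^ I i with hX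
  have hX0 : X 0 = 1 := by simp [hX]
  have hXadd : ∀ I J, X (I + J) = X I * X J := by
    intro I J; simp [hX, pow_add, Finset.prod_mul_distrib]
  have hX1 : ∀ i, X (Finsupp.single i 1) = x i := by
    intro i
    simp only [hX]
    rw [Finset.prod_eq_single i]
    · simp
    · intro j _ hj
      simp [Finsupp.single_apply, hj.symm]
    · simp
  have hXsum : ∀ I, HasSum (fun J => (Pi.single I (1 : K) : (Fin n →₀ ℕ) → K) J • X J) (X I) := by
    intro I
    have := hasSum_single (f := fun J => (Pi.single I (1 : K) : (Fin n →₀ ℕ) → K) J • X J) I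
      (fun J hJ => by simp [Pi.single_eq_of_ne hJ])
    simpa using this
  have hXnorm : ∀ I, ‖X I‖ = 1 := by
    intro I
    refine (hnorm _ _ (hXsum I)).unique ⟨?_, ?_⟩
    · rintro _ ⟨J, rfl⟩
      by_cases h : J = I
      · subst h; simp
      · simp [Pi.single_eq_of_ne h]
    · intro b hb
      have := hb ⟨I, rfl⟩
      simpa using this
  have h1 : ‖(1 : A)‖ = 1 := hX0 ▸ hXnorm 0
  -- the unit
  have hsurj : Function.Surjective (fun y => m 1 y) :=
    tate_surj c hc0 hc1 _ (fun a b => map_sub _ a b) (fun a => by simpa using hcl 1 a)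
  obtain ⟨e, he⟩ := hsurj 1
  simp only at he
  have hunit : ∀ y, m e y = y := by
    intro y
    obtain ⟨z, rfl⟩ := hsurj y
    simp only
    rw [← hassoc, hcomm e 1, he]
  have he1 : ‖(1 : A) - e‖ ≤ c * ‖e‖ := by
    have := hcl 1 e
    rwa [he, one_mul] at this
  have hen : ‖e‖ = 1 := by rw [← tate_norm_eq hc1 he1, h1]
  obtain ⟨P, hP0, hPadd, hP1⟩ := tate_exists_powers (fun a b => m a b) e hcomm hassoc hunit n x
  have hPX : ∀ I, ‖P I - X I‖ ≤ c := by
    have hstep : ∀ (i : Fin n) (I), ‖P I - X I‖ ≤ c →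
        ‖P (Finsupp.single i 1 + I) - X (Finsupp.single i 1 + I)‖ ≤ c := by
      intro i I ih
      have hPn : ‖P I‖ = 1 := by
        rw [← hXnorm I]
        exact tate_norm_eq hc1 (by rw [hXnorm I, mul_one]; exact ih)
      have hxi : ‖x i‖ = 1 := by rw [← hX1, hXnorm]
      rw [hPadd, hXadd, hP1, hX1]
      have e1 : m (x i) (P I) - x i * X I
          = (m (x i) (P I) - x i * P I) + x i * (P I - X I) := by ring
      rw [e1]
      refine (IsUltrametricDist.norm_add_le_max _ _).trans (max_le ?_ ?_)
      · refine (hcl _ _).trans ?_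
        have := norm_mul_le (x i) (P I)
        rw [hxi, hPn] at this
        nlinarith
      · refine (norm_mul_le _ _).trans ?_
        rw [hxi, one_mul]; exact ih
    intro I
    induction I using Finsupp.induction with
    | zero => rw [hP0, hX0, norm_sub_rev]; simpa [hen] using he1
    | single_add i k I _ _ ih =>
      clear * - ih hstep
      induction k with
      | zero => simpa using ih
      | succ k ihk =>
        have := hstep i _ ihk
        rwa [← add_assoc, ← Finsupp.single_add, add_comm 1 k] at this
  have hPn : ∀ I, ‖P I‖ = 1 := by
    intro I
    rw [← hXnorm I]
    exact tate_norm_eq hc1 (by rw [hXnorm I, mul_one]; exact hPX I)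
  -- coefficients
  choose a ha hauniq using hexp
  have ha' : ∀ u, HasSum (fun I => a u I • X I) u := ha
  have huniq : ∀ u b, HasSum (fun I => b I • X I) u → b = a u := fun u b hb => hauniq u b hb
  have hsum : ∀ u, Summable (fun I => a u I • P I) := by
    intro u
    apply NonarchimedeanAddGroup.summable_of_tendsto_cofinite_zero
    have := (ha' u).summable.tendsto_cofinite_zero
    rw [tendsto_zero_iff_norm_tendsto_zero] at this ⊢
    simpa [norm_smul, hPn, hXnorm] using this
  have haadd : ∀ u v, a (u + v) = a u + a v := by
    intro u v
    symm
    apply huniq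
    simpa [add_smul] using (ha' u).add (ha' v)
  have hasmul : ∀ (r : K) u, a (r • u) = r • a u := by
    intro r u
    symm
    apply huniq
    simpa [mul_smul] using (ha' u).const_smul r
  let φ : A →ₗ[K] A :=
    { toFun := fun u => ∑' I, a u I • P I
      map_add' := fun u v => by
        rw [← (hsum u).tsum_add (hsum v)]
        simp [haadd, add_smul]
      map_smul' := fun r u => by
        simp only [RingHom.id_apply]
        rw [← (hsum u).tsum_const_smul r]
        simp [hasmul, mul_smul] }
  have hφ : ∀ u, φ u = ∑' I, a u I • P I := fun u => rfl
  have hφX : ∀ I, φ (X I) = P I := by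
    intro I
    rw [hφ, ← huniq _ _ (hXsum I), tsum_eq_single I]
    · simp
    · intro J hJ; simp [Pi.single_eq_of_ne hJ]
  have hφc : ∀ u, ‖φ u - u‖ ≤ c * ‖u‖ := by
    intro u
    have h2 : φ u - u = ∑' I, (a u I • P I - a u I • X I) :=
      (((hsum u).hasSum.sub (ha' u)).tsum_eq).symm
    rw [h2]
    apply IsUltrametricDist.norm_tsum_le_of_forall_le_of_nonneg (by positivity)
    intro I
    rw [← smul_sub, norm_smul, mul_comm]
    have h3 : ‖a u I‖ ≤ ‖u‖ := (hnorm u _ (ha' u)).1 ⟨I, rfl⟩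
    exact mul_le_mul (hPX I) h3 (norm_nonneg _) hc0.le
  have hiso : ∀ u, ‖φ u‖ = ‖u‖ := fun u => tate_norm_eq hc1 (hφc u)
  let Φ : A →L[K] A := φ.mkContinuous 1 (fun u => by rw [hiso, one_mul])
  have hΦ : ∀ u, Φ u = φ u := fun u => rfl
  have hext : ∀ f g : A →L[K] A, (∀ I, f (X I) = g (X I)) → f = g := by
    intro f g h
    ext u
    have hf := (ha' u).mapL f
    have hg := (ha' u).mapL g
    simp only [map_smul, h] at hf hg
    exact hf.unique hg
  have hmulL : ∀ u : A, ∃ f : A →L[K] A, ∀ v, f v = u * v := fun u =>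
    ⟨(LinearMap.mulLeft K u).mkContinuous ‖u‖ (fun v => norm_mul_le u v), fun v => rfl⟩
  have hmul1 : ∀ J v, φ (X J * v) = m (P J) (φ v) := by
    intro J v
    obtain ⟨f, hf⟩ := hmulL (X J)
    have := hext (Φ.comp f) ((m (P J)).comp Φ) (fun I => by
      simp [hf, hΦ, ← hXadd, hφX, hPadd])
    have := congrArg (fun F : A →L[K] A => F v) this
    simpa [hf, hΦ] using this
  refine ⟨φ, ⟨?_, tate_surj c hc0 hc1 _ (fun a b => map_sub _ a b) hφc⟩, hiso, ?_, hφc⟩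
  · rw [injective_iff_map_eq_zero]
    intro u hu
    rw [← norm_eq_zero, ← hiso, hu, norm_zero]
  · intro u v
    obtain ⟨f, hf⟩ := hmulL u
    have := hext (Φ.comp f) ((m (φ u)).comp Φ) (fun I => by
      simp only [ContinuousLinearMap.comp_apply, hf, hΦ]
      rw [mul_comm, hmul1, hφX, hcomm])
    have := congrArg (fun F : A →L[K] A => F v) this
    simpa [hf, hΦ] using this
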